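/- Let z ∈ ℂ and suppose there exists μ > 0 such that |z| < μ/Ψ(μ). Then the tree sum 𝓑(|z|) is finite and satisfies 𝓑(|z|) ≤ 1/(1 − |z|·Ψ(μ)/μ). -/

import Mathlib

open MeasureTheory ENNReal
open scoped Classical

noncomputable section

/-- Pair weight `w(x,y) = exp(-β φ(x-y))`, with `exp(-(+∞)) = 0`. -/
def pairW {d : ℕ} (β : ℝ) (φ : (Fin d → ℝ) → ℝ≥0∞) (x y : Fin d → ℝ) : ℝ :=
  if φ (x - y) = ∞ then 0 else Real.exp (-(β * (φ (x - y)).toReal))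

/-- Truncated weight `ω^T_n`: sum over connected graphs on `{1,…,n}`. -/
def omegaT {S : Type*} (w : S → S → ℝ) (n : ℕ) (x : Fin n → S) : ℝ :=
  ∑ G : SimpleGraph (Fin n),
    if G.Connected then
      ∏ p ∈ Finset.univ.filter (fun p : Fin n × Fin n => p.1 < p.2 ∧ G.Adj p.1 p.2),
        (w (x p.1) (x p.2) - 1)
    else 0

/-- `φ_n(x; x_1,…,x_n) = Π_i (1 - w(x,x_i)) Π_{i<j} w(x_i,x_j)`. -/
def phiVertex {S : Type*} (w : S → S → ℝ) (n : ℕ) (x : S) (y : Fin n → S) : ℝ :=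
  (∏ i, (1 - w x (y i))) *
    ∏ p ∈ Finset.univ.filter (fun p : Fin n × Fin n => p.1 < p.2), w (y p.1) (y p.2)

/-- `g(n) = ∫_{ℝ^{dn}} φ_n(0; x_1,…,x_n) dx`. -/
def gCoef {d : ℕ} (β : ℝ) (φ : (Fin d → ℝ) → ℝ≥0∞) (n : ℕ) : ℝ≥0∞ :=
  ∫⁻ y : Fin n → Fin d → ℝ, ENNReal.ofReal (phiVertex (pairW β φ) n 0 y)

/-- The vertex sum `Ψ(t) = 1 + Σ_{n≥1} g(n) t^n/n!` (extended to `t ∈ [0,∞]`). -/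
def vertexSum {d : ℕ} (β : ℝ) (φ : (Fin d → ℝ) → ℝ≥0∞) (t : ℝ≥0∞) : ℝ≥0∞ :=
  1 + ∑' n : ℕ, gCoef β φ (n + 1) * t ^ (n + 1) / ((n + 1).factorial : ℝ≥0∞)

/-- The children of vertex `i` in a tree on `{0,…,n}` rooted at `0`. -/
def childrenF {n : ℕ} (τ : SimpleGraph (Fin (n + 1))) (i : Fin (n + 1)) :
    Finset (Fin (n + 1)) :=
  Finset.univ.filter (fun j => τ.Adj i j ∧ τ.dist 0 j = τ.dist 0 i + 1)

/-- `φ_{|t|}(x; (y_j)_{j∈t})`, the vertex weight of `x` with the family of children `t`. -/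
def phiFinset {S : Type*} {n : ℕ} (w : S → S → ℝ) (x : S)
    (t : Finset (Fin n)) (y : Fin n → S) : ℝ :=
  (∏ j ∈ t, (1 - w x (y j))) *
    ∏ p ∈ (t ×ˢ t).filter (fun p => p.1 < p.2), w (y p.1) (y p.2)

/-- `B_n(x_0; x_1,…,x_n)`: sum over trees rooted at `0` of the product of vertex weights. -/
def treeB {S : Type*} (w : S → S → ℝ) (n : ℕ) (x : Fin (n + 1) → S) : ℝ :=
  ∑ τ : SimpleGraph (Fin (n + 1)),
    if τ.IsTree then ∏ i : Fin (n + 1), phiFinset w (x i) (childrenF τ i) x else 0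

/-- The tree sum `𝓑(r) = 1 + Σ_{n≥1} (r^n/n!) ∫ B_n(0;x_1,…,x_n) dx`. -/
def treeSum {d : ℕ} (β : ℝ) (φ : (Fin d → ℝ) → ℝ≥0∞) (r : ℝ) : ℝ≥0∞ :=
  1 + ∑' n : ℕ, ENNReal.ofReal (r ^ (n + 1) / (n + 1).factorial) *
    ∫⁻ y : Fin (n + 1) → Fin d → ℝ,
      ENNReal.ofReal (treeB (pairW β φ) (n + 1) (Fin.cons 0 y))

/-- `c` lists the children of each vertex of a forest with set of roots `L` and set of remaining
vertices `V`; it is empty outside the forest. -/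
structure IsRootedForest {ι : Type*} [DecidableEq ι] (L V : Finset ι) (c : ι → Finset ι) :
    Prop where
  subset : ∀ i, c i ⊆ V
  eq_empty : ∀ i ∉ L ∪ V, c i = ∅
  disjoint : ∀ i j, i ≠ j → Disjoint (c i) (c j)
  exists_parent : ∃ h : ι → ℕ, ∀ v ∈ V, ∃ i, h i < h v ∧ v ∈ c i

namespace IsRootedForest

variable {ι : Type*} [DecidableEq ι] {L V : Finset ι} {c : ι → Finset ι}

theorem eq_empty_of_roots_eq_empty (hc : IsRootedForest ∅ V c) : V = ∅ := by
  obtain ⟨h, hh⟩ := hc.exists_parent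
  by_contra hV
  obtain ⟨v, hv, hmin⟩ := V.exists_min_image h (Finset.nonempty_iff_ne_empty.2 hV)
  obtain ⟨i, hi, hvi⟩ := hh v hv
  have hiV : i ∈ V := by
    by_contra hiV
    simp [hc.eq_empty i (by simpa using hiV)] at hvi
  exact absurd (hmin i hiV) (not_le.2 hi)

/-- Removing a root `i` turns its children into roots. -/
theorem update (hc : IsRootedForest L V c) {i : ι} (hi : i ∈ L) :
    IsRootedForest (L.erase i ∪ c i) (V \ c i) (Function.update c i ∅) where
  subset j := by
    by_cases hj : j = i
    · simp [hj]
    · simpa [hj, Finset.subset_sdiff] using ⟨hc.subset j, hc.disjoint j i hj⟩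
  eq_empty j hj := by
    by_cases hji : j = i
    · simp [hji]
    · rw [Function.update_of_ne hji]
      apply hc.eq_empty
      simp only [Finset.mem_union, Finset.mem_erase, Finset.mem_sdiff] at hj ⊢
      tauto
  disjoint j k hjk := by
    by_cases hj : j = i
    · simp [hj]
    by_cases hk : k = i
    · simp [hk]
    simpa [hj, hk] using hc.disjoint j k hjk
  exists_parent := by
    obtain ⟨h, hh⟩ := hc.exists_parent
    refine ⟨h, fun v hv => ?_⟩
    rw [Finset.mem_sdiff] at hv
    obtain ⟨j, hj, hvj⟩ := hh v hv.1
    have hji : j ≠ i := by rintro rfl; exact hv.2 hvj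
    exact ⟨j, hj, by simpa [hji] using hvj⟩

end IsRootedForest

/-- The sum over forests with roots `L` and remaining vertices `V` of a product of vertex
weights. -/
def forestSum {ι R : Type*} [Fintype ι] [DecidableEq ι] [CommSemiring R]
    (W : ι → Finset ι → R) (L V : Finset ι) : R :=
  ∑ c : ι → Finset ι with IsRootedForest L V c, ∏ j ∈ L ∪ V, W j (c j)

theorem forestSum_empty_le {ι : Type*} [Fintype ι] [DecidableEq ι] (W : ι → Finset ι → ℝ≥0∞)
    (V : Finset ι) : forestSum W ∅ V ≤ if V = ∅ then 1 else 0 := by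
  unfold forestSum
  split_ifs with hV
  · subst hV
    have : ∀ c ∈ Finset.univ.filter (fun c : ι → Finset ι => IsRootedForest ∅ ∅ c),
        c = fun _ => ∅ := fun c hc => by
      funext i
      exact ((Finset.mem_filter.1 hc).2).eq_empty i (by simp)
    refine (Finset.sum_le_sum_of_subset (t := {fun _ => ∅}) fun c hc => by
      simp [this c hc]).trans ?_
    simp
  · rw [Finset.filter_false_of_mem fun c _ hc => hV hc.eq_empty_of_roots_eq_empty]
    simp

theorem forestSum_le_sum_powerset {ι : Type*} [Fintype ι] [DecidableEq ι]
    (W : ι → Finset ι → ℝ≥0∞) {L V : Finset ι} (hLV : Disjoint L V) {i : ι} (hi : i ∈ L) :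
    forestSum W L V ≤
      ∑ C ∈ V.powerset, W i C * forestSum W (L.erase i ∪ C) (V \ C) := by
  unfold forestSum
  have hiV : i ∉ V := Finset.disjoint_left.1 hLV hi
  rw [← Finset.sum_fiberwise_of_maps_to (g := fun c : ι → Finset ι => c i) (t := V.powerset)
    fun c hc => Finset.mem_powerset.2 ((Finset.mem_filter.1 hc).2.subset i)]
  refine Finset.sum_le_sum fun C hC => ?_
  rw [Finset.mem_powerset] at hC
  set F := (Finset.univ.filter fun c : ι → Finset ι => IsRootedForest L V c).filter
    fun c => c i = C with hF
  have hmem : ∀ c ∈ F, IsRootedForest L V c ∧ c i = C := fun c hc => by simpa [hF] using hc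
  have hU : (L.erase i ∪ C) ∪ V \ C = (L ∪ V).erase i := by
    ext j
    have := @hC j
    simp only [Finset.mem_union, Finset.mem_erase, Finset.mem_sdiff]
    by_cases hj : j = i
    · subst hj; tauto
    · tauto
  have hinj : Set.InjOn (fun c : ι → Finset ι => Function.update c i ∅) F := by
    intro c hc d hd hcd
    have hci := (hmem c hc).2
    have hdi := (hmem d hd).2
    funext j
    by_cases hj : j = i
    · rw [hj, hci, hdi]
    · simpa [hj] using congrFun hcd j
  have hsub : F.image (fun c : ι → Finset ι => Function.update c i ∅) ⊆
      Finset.univ.filter fun c => IsRootedForest (L.erase i ∪ C) (V \ C) c := by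
    intro c hc
    obtain ⟨d, hd, rfl⟩ := Finset.mem_image.1 hc
    obtain ⟨hd1, rfl⟩ := hmem d hd
    simpa using hd1.update hi
  rw [hU]
  refine le_trans (le_of_eq ?_) (mul_le_mul_right (Finset.sum_le_sum_of_subset hsub) _)
  rw [Finset.sum_image hinj, Finset.mul_sum]
  refine Finset.sum_congr rfl fun c hc => ?_
  rw [← Finset.mul_prod_erase _ _ (Finset.mem_union_left V hi), (hmem c hc).2]
  congr 1
  exact Finset.prod_congr rfl fun j hj => by
    rw [Function.update_of_ne (Finset.ne_of_mem_erase hj)]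

/-- Normalized total weight of forests with `m` roots and `n` further vertices, where a vertex with
`k` children has weight `γ k`, and where at most `N` vertices are explored. -/
def forestCoef (γ : ℕ → ℝ≥0∞) : ℕ → ℕ → ℕ → ℝ≥0∞
  | N + 1, m + 1, n => ∑ p ∈ Finset.HasAntidiagonal.antidiagonal n, γ p.1 * forestCoef γ N (m + p.1) p.2
  | _, _, n => if n = 0 then 1 else 0

theorem forestCoef_zero_roots (γ : ℕ → ℝ≥0∞) (N n : ℕ) :
    forestCoef γ N 0 n = if n = 0 then 1 else 0 := by
  cases N <;> rfl

theorem tsum_forestCoef_le (γ : ℕ → ℝ≥0∞) (r H : ℝ≥0∞) (hH1 : 1 ≤ H)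
    (hH : ∑' k, γ k * (r * H) ^ k ≤ H) (N m : ℕ) :
    ∑' n, r ^ n * forestCoef γ N m n ≤ H ^ m := by
  have h0 : ∑' n, r ^ n * (if n = 0 then (1 : ℝ≥0∞) else 0) = 1 := by
    rw [tsum_eq_single 0 (by simp +contextual)]; simp
  induction N generalizing m with
  | zero => simpa [forestCoef, h0] using one_le_pow₀ hH1
  | succ N ih =>
    cases m with
    | zero => simp [forestCoef]
    | succ m =>
      calc ∑' n, r ^ n * forestCoef γ (N + 1) (m + 1) n
          = ∑' n, ∑ p ∈ Finset.HasAntidiagonal.antidiagonal n,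
              γ p.1 * r ^ p.1 * (r ^ p.2 * forestCoef γ N (m + p.1) p.2) := by
            refine tsum_congr fun n => ?_
            rw [forestCoef, Finset.mul_sum]
            refine Finset.sum_congr rfl fun p hp => ?_
            rw [← Finset.HasAntidiagonal.mem_antidiagonal.1 hp, pow_add]
            ring
        _ = ∑' p : ℕ × ℕ, γ p.1 * r ^ p.1 * (r ^ p.2 * forestCoef γ N (m + p.1) p.2) := by
            rw [← Finset.HasAntidiagonal.sigmaAntidiagonalEquivProd.tsum_eq, ENNReal.tsum_sigma']
            refine tsum_congr fun n => ?_
            rw [← Finset.tsum_subtype]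
            rfl
        _ = ∑' k, γ k * r ^ k * ∑' l, r ^ l * forestCoef γ N (m + k) l := by
            rw [ENNReal.tsum_prod']
            simp_rw [ENNReal.tsum_mul_left]
        _ ≤ ∑' k, γ k * r ^ k * H ^ (m + k) := by
            gcongr
            exact ih _
        _ = H ^ m * ∑' k, γ k * (r * H) ^ k := by
            rw [← ENNReal.tsum_mul_left]
            refine tsum_congr fun k => ?_
            rw [pow_add, mul_pow]; ring
        _ ≤ H ^ m * H := by gcongr
        _ = H ^ (m + 1) := (pow_succ H m).symm

theorem lmarginal_forestSum_le {ι S : Type*} [Fintype ι] [DecidableEq ι] [MeasurableSpace S]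
    (ν : Measure S) [SigmaFinite ν] (W : (ι → S) → ι → Finset ι → ℝ≥0∞)
    (hmeas : ∀ i C, Measurable fun x => W x i C)
    (hdep : ∀ i C x y, (∀ j ∈ insert i C, x j = y j) → W x i C = W y i C)
    (g : ℕ → ℝ≥0∞)
    (hint : ∀ i C x, i ∉ C → (∫⋯∫⁻_C, (fun x => W x i C) ∂(fun _ => ν)) x = g C.card)
    (N : ℕ) (L V : Finset ι) (hLV : Disjoint L V) (hN : L.card + V.card ≤ N) (x : ι → S) :
    (∫⋯∫⁻_V, (fun x => forestSum (W x) L V) ∂(fun _ => ν)) x ≤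
      V.card.factorial * forestCoef (fun k => g k / k.factorial) N L.card V.card := by
  have hmeasF : ∀ L V, Measurable fun x => forestSum (W x) L V := fun L V =>
    Finset.measurable_sum _ fun c _ => Finset.measurable_prod _ fun j _ => hmeas j (c j)
  induction N generalizing L V x with
  | zero =>
    obtain rfl : L = ∅ := Finset.card_eq_zero.1 (by omega)
    obtain rfl : V = ∅ := Finset.card_eq_zero.1 (by omega)
    simpa [forestCoef] using forestSum_empty_le (W x) ∅
  | succ N ih =>
    rcases L.eq_empty_or_nonempty with rfl | ⟨i, hi⟩
    · refine (lmarginal_mono (fun x => forestSum_empty_le (W x) V) x).trans ?_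
      rw [Finset.card_empty, forestCoef_zero_roots]
      by_cases hV : V = ∅
      · simp [hV]
      · simp [hV, lmarginal]
    · have hiV : i ∉ V := Finset.disjoint_left.1 hLV hi
      obtain ⟨m, hm⟩ : ∃ m, L.card = m + 1 := ⟨L.card - 1, by
        have := Finset.card_pos.2 ⟨i, hi⟩; omega⟩
      have hstep : ∀ C ∈ V.powerset,
          (∫⋯∫⁻_V, (fun x => W x i C * forestSum (W x) (L.erase i ∪ C) (V \ C))
            ∂(fun _ => ν)) x ≤
          g C.card * ((V.card - C.card).factorial *
            forestCoef (fun k => g k / k.factorial) N (m + C.card) (V.card - C.card)) := by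
        intro C hC
        rw [Finset.mem_powerset] at hC
        have hiC : i ∉ C := fun h => hiV (hC h)
        have hLC : Disjoint (L.erase i) C :=
          (hLV.mono_right hC).mono_left (Finset.erase_subset _ _)
        have hcardL : (L.erase i ∪ C).card = m + C.card := by
          rw [Finset.card_union_of_disjoint hLC, Finset.card_erase_of_mem hi, hm,
            Nat.add_sub_cancel]
        have hcardV : (V \ C).card = V.card - C.card := Finset.card_sdiff_of_subset hC
        have hCV := Finset.card_le_card hC
        have hdisj : Disjoint (L.erase i ∪ C) (V \ C) := by
          rw [Finset.disjoint_union_left]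
          exact ⟨hLV.mono (Finset.erase_subset _ _) Finset.sdiff_subset, Finset.disjoint_sdiff⟩
        set K : ℝ≥0∞ := (V.card - C.card).factorial *
            forestCoef (fun k => g k / k.factorial) N (m + C.card) (V.card - C.card)
        have hinner : ∀ x, (∫⋯∫⁻_(V \ C), (fun x => W x i C *
            forestSum (W x) (L.erase i ∪ C) (V \ C)) ∂(fun _ => ν)) x ≤ W x i C * K := by
          intro x
          have h1 : ∀ y : (∀ _ : (V \ C : Finset ι), S),
              W (Function.updateFinset x (V \ C) y) i C = W x i C := by
            intro y
            refine hdep _ _ _ _ fun j hj => ?_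
            rw [Function.updateFinset_def]
            refine dif_neg ?_
            rw [Finset.mem_sdiff]
            rcases Finset.mem_insert.1 hj with rfl | hj
            · tauto
            · tauto
          simp only [lmarginal, h1]
          rw [lintegral_const_mul (W x i C) (f := fun y : (∀ _ : (V \ C : Finset ι), S) =>
            forestSum (W (Function.updateFinset x (V \ C) y)) (L.erase i ∪ C) (V \ C))
            ((hmeasF _ _).comp measurable_updateFinset)]
          gcongr
          have := ih (L.erase i ∪ C) (V \ C) hdisj (by rw [hcardL, hcardV]; omega) x
          rwa [hcardL, hcardV] at this
        have hunion := lmarginal_union (fun _ : ι => ν)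
          (fun x => W x i C * forestSum (W x) (L.erase i ∪ C) (V \ C))
          ((hmeas i C).mul (hmeasF _ _)) (Finset.disjoint_sdiff (s := C) (t := V))
        rw [Finset.union_sdiff_of_subset hC] at hunion
        rw [hunion]
        refine (lmarginal_mono (fun x => hinner x) x).trans (le_of_eq ?_)
        rw [← hint i C x hiC]
        simp only [lmarginal]
        exact lintegral_mul_const _ ((hmeas i C).comp measurable_updateFinset)
      calc _ ≤ (∫⋯∫⁻_V, (fun x => ∑ C ∈ V.powerset,
              W x i C * forestSum (W x) (L.erase i ∪ C) (V \ C)) ∂(fun _ => ν)) x :=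
            lmarginal_mono (fun x => forestSum_le_sum_powerset (W x) hLV hi) x
        _ = ∑ C ∈ V.powerset, (∫⋯∫⁻_V, (fun x =>
              W x i C * forestSum (W x) (L.erase i ∪ C) (V \ C)) ∂(fun _ => ν)) x := by
            simp only [lmarginal]
            exact lintegral_finsetSum _ fun C _ =>
              ((hmeas i C).mul (hmeasF _ _)).comp measurable_updateFinset
        _ ≤ ∑ C ∈ V.powerset, g C.card * ((V.card - C.card).factorial *
              forestCoef (fun k => g k / k.factorial) N (m + C.card) (V.card - C.card)) :=
            Finset.sum_le_sum hstep
        _ = _ := by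
            rw [Finset.sum_powerset_apply_card (fun k => g k * ((V.card - k).factorial *
              forestCoef (fun k => g k / k.factorial) N (m + k) (V.card - k))), hm, forestCoef,
              Finset.mul_sum, Finset.Nat.sum_antidiagonal_eq_sum_range_succ_mk]
            refine Finset.sum_congr rfl fun k hk => ?_
            have hk : k ≤ V.card := Nat.lt_succ_iff.1 (Finset.mem_range.1 hk)
            rw [← Nat.choose_mul_factorial_mul_factorial hk, nsmul_eq_mul]
            push_cast
            have hk0 : ((k.factorial : ℕ) : ℝ≥0∞) ≠ 0 := by exact_mod_cast k.factorial_ne_zero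
            calc _ = ((V.card.choose k : ℝ≥0∞) * (V.card - k).factorial *
                  forestCoef (fun k => g k / k.factorial) N (m + k) (V.card - k)) *
                  g k := by ring
              _ = ((V.card.choose k : ℝ≥0∞) * (V.card - k).factorial *
                  forestCoef (fun k => g k / k.factorial) N (m + k) (V.card - k)) *
                  (k.factorial * (g k / k.factorial)) := by
                rw [ENNReal.mul_div_cancel hk0 (ENNReal.natCast_ne_top _)]
              _ = _ := by ring

theorem isRootedForest_childrenF {n : ℕ} {τ : SimpleGraph (Fin (n + 1))} (hτ : τ.IsTree) :
    IsRootedForest {0} {0}ᶜ (childrenF τ) where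
  subset i j hj := by
    simp only [childrenF, Finset.mem_filter, Finset.mem_univ, true_and] at hj
    simp only [Finset.mem_compl, Finset.mem_singleton]
    rintro rfl
    simp at hj
  eq_empty i hi := by simp at hi
  disjoint i j hij := by
    refine Finset.disjoint_left.2 fun k hki hkj => hij ?_
    simp only [childrenF, Finset.mem_filter, Finset.mem_univ, true_and] at hki hkj
    obtain ⟨p, hp⟩ := hτ.1.exists_walk_length_eq_dist 0 i
    obtain ⟨q, hq⟩ := hτ.1.exists_walk_length_eq_dist 0 j
    have hp' := (p.concat hki.1).isPath_of_length_eq_dist (by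
      rw [SimpleGraph.Walk.length_concat, hp, hki.2])
    have hq' := (q.concat hkj.1).isPath_of_length_eq_dist (by
      rw [SimpleGraph.Walk.length_concat, hq, hkj.2])
    have h := congrArg SimpleGraph.Walk.penultimate ((hτ.existsUnique_path 0 k).unique hp' hq')
    simpa using h
  exists_parent := by
    refine ⟨τ.dist 0, fun v hv => ?_⟩
    obtain ⟨p, hp⟩ := hτ.1.exists_walk_length_eq_dist 0 v
    have hv0 : v ≠ 0 := by simpa using hv
    have hnil : ¬ p.Nil := fun h => hv0 h.eq.symm
    have hadj := p.adj_penultimate hnil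
    have h1 : τ.dist 0 p.penultimate ≤ p.length - 1 := by
      simpa using SimpleGraph.dist_le p.dropLast
    have h2 : 0 < p.length := by
      rw [hp]; exact hτ.1.pos_dist_of_ne hv0.symm
    have h3 := hadj.diff_dist_adj (u := 0)
    refine ⟨p.penultimate, by omega, ?_⟩
    simp only [childrenF, Finset.mem_filter, Finset.mem_univ, true_and]
    exact ⟨hadj, by omega⟩

theorem childrenF_injOn (n : ℕ) :
    Set.InjOn (childrenF (n := n)) {τ : SimpleGraph (Fin (n + 1)) | τ.IsTree} := by
  have key : ∀ τ : SimpleGraph (Fin (n + 1)), τ.IsTree → ∀ i j,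
      τ.Adj i j ↔ j ∈ childrenF τ i ∨ i ∈ childrenF τ j := by
    intro τ hτ i j
    simp only [childrenF, Finset.mem_filter, Finset.mem_univ, true_and]
    constructor
    · intro h
      have h1 := h.diff_dist_adj (u := 0)
      have h2 := hτ.dist_ne_of_adj 0 h
      rcases h1 with h1 | h1 | h1
      · exact absurd h1.symm h2
      · exact Or.inl ⟨h, h1⟩
      · refine Or.inr ⟨h.symm, ?_⟩
        omega
    · rintro (h | h)
      exacts [h.1, h.1.symm]
  intro τ hτ σ hσ h
  ext i j
  rw [key τ hτ, key σ hσ, h]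

theorem ofReal_treeB_le_forestSum {S : Type*} (w : S → S → ℝ) (h0 : ∀ a b, 0 ≤ w a b)
    (h1 : ∀ a b, w a b ≤ 1) (n : ℕ) (x : Fin (n + 1) → S) :
    ENNReal.ofReal (treeB w n x) ≤
      forestSum (fun i C => ENNReal.ofReal (phiFinset w (x i) C x)) {0} {0}ᶜ := by
  have hφ : ∀ i C, 0 ≤ phiFinset w (x i) C x := fun i C =>
    mul_nonneg (Finset.prod_nonneg fun j _ => sub_nonneg.2 (h1 _ _))
      (Finset.prod_nonneg fun j _ => h0 _ _)
  unfold treeB forestSum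
  rw [← Finset.sum_filter, ENNReal.ofReal_sum_of_nonneg
    fun τ _ => Finset.prod_nonneg fun i _ => hφ _ _]
  simp_rw [ENNReal.ofReal_prod_of_nonneg fun i _ => hφ i _]
  rw [← Finset.sum_image (f := fun c : Fin (n + 1) → Finset (Fin (n + 1)) =>
    ∏ i, ENNReal.ofReal (phiFinset w (x i) (c i) x)) (g := childrenF)
    ((childrenF_injOn n).mono fun τ hτ => by simpa using hτ)]
  simp only [Finset.union_compl]
  refine Finset.sum_le_sum_of_subset fun c hc => ?_
  obtain ⟨τ, hτ, rfl⟩ := Finset.mem_image.1 hc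
  simpa using isRootedForest_childrenF (by simpa using hτ)

theorem lmarginal_eq_lintegral_of_equiv {ι κ S : Type*} [DecidableEq ι] [Fintype κ]
    [MeasurableSpace S] (ν : Measure S) [SigmaFinite ν] (s : Finset ι) (e : κ ≃ s)
    (f : (ι → S) → ℝ≥0∞) (x : ι → S) :
    (∫⋯∫⁻_s, f ∂(fun _ => ν)) x =
      ∫⁻ y : κ → S, f (Function.updateFinset x s (y ∘ e.symm)) ∂Measure.pi fun _ => ν := by
  have h := (measurePreserving_piCongrLeft (fun _ : s => ν) e).lintegral_map_equiv
    (fun y => f (Function.updateFinset x s y))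
  rw [lmarginal, h]
  refine lintegral_congr fun y => ?_
  congr 2
  funext i
  obtain ⟨k, rfl⟩ := e.surjective i
  rw [MeasurableEquiv.coe_piCongrLeft, Equiv.piCongrLeft_apply_apply]
  simp

theorem phiFinset_eq_phiVertex {S : Type*} {n k : ℕ} (w : S → S → ℝ) (a : S)
    (C : Finset (Fin n)) (e : Fin k ≃o C) (y : Fin n → S) :
    phiFinset w a C y = phiVertex w k a fun i => y (e i) := by
  unfold phiFinset phiVertex
  have hC : ∀ f : Fin n → ℝ, ∏ j ∈ C, f j = ∏ i, f (e i) := fun f => by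
    rw [← Finset.prod_coe_sort, ← e.toEquiv.prod_comp]; rfl
  rw [hC, Finset.prod_filter, Finset.prod_product, Finset.prod_filter, ← Finset.univ_product_univ,
    Finset.prod_product, hC]
  congr 1
  refine Finset.prod_congr rfl fun i _ => ?_
  rw [hC]
  refine Finset.prod_congr rfl fun j _ => ?_
  simp

section pairW

variable {d : ℕ} {β : ℝ} {φ : (Fin d → ℝ) → ℝ≥0∞}

theorem pairW_nonneg (x y : Fin d → ℝ) : 0 ≤ pairW β φ x y := by
  unfold pairW
  split_ifs <;> positivity

theorem pairW_le_one (hβ : 0 ≤ β) (x y : Fin d → ℝ) : pairW β φ x y ≤ 1 := by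
  unfold pairW
  split_ifs
  · exact zero_le_one
  · exact Real.exp_le_one_iff.2 (neg_nonpos.2 (mul_nonneg hβ ENNReal.toReal_nonneg))

theorem measurable_pairW (hφ : Measurable φ) :
    Measurable fun p : (Fin d → ℝ) × (Fin d → ℝ) => pairW β φ p.1 p.2 := by
  have h : Measurable fun p : (Fin d → ℝ) × (Fin d → ℝ) => φ (p.1 - p.2) :=
    hφ.comp (measurable_fst.sub measurable_snd)
  exact Measurable.ite (h (measurableSet_singleton ∞)) measurable_const
    (Real.measurable_exp.comp (h.ennreal_toReal.const_mul β).neg)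

theorem phiVertex_pairW_sub (n : ℕ) (a : Fin d → ℝ) (y : Fin n → Fin d → ℝ) :
    phiVertex (pairW β φ) n 0 (y - fun _ => a) = phiVertex (pairW β φ) n a y := by
  simp [phiVertex, pairW]

theorem lintegral_phiVertex_pairW (n : ℕ) (a : Fin d → ℝ) :
    ∫⁻ y : Fin n → Fin d → ℝ, ENNReal.ofReal (phiVertex (pairW β φ) n a y) = gCoef β φ n := by
  rw [← lintegral_congr fun y => congrArg ENNReal.ofReal (phiVertex_pairW_sub n a y)]
  exact lintegral_sub_right_eq_self
    (fun y : Fin n → Fin d → ℝ => ENNReal.ofReal (phiVertex (pairW β φ) n 0 y)) fun _ => a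

theorem measurable_phiFinset_pairW (hφ : Measurable φ) {n : ℕ} (i : Fin n)
    (C : Finset (Fin n)) :
    Measurable fun x : Fin n → Fin d → ℝ => phiFinset (pairW β φ) (x i) C x := by
  have h : ∀ i j, Measurable fun x : Fin n → Fin d → ℝ => pairW β φ (x i) (x j) := fun i j =>
    (measurable_pairW hφ).comp
      (g := fun p : (Fin d → ℝ) × (Fin d → ℝ) => pairW β φ p.1 p.2)
      (f := fun x : Fin n → Fin d → ℝ => (x i, x j))
      ((measurable_pi_apply i).prodMk (measurable_pi_apply j))
  exact (Finset.measurable_prod _ fun j _ => measurable_const.sub (h i j)).mul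
    (Finset.measurable_prod _ fun p _ => h p.1 p.2)

theorem lmarginal_phiFinset_pairW {n : ℕ} {i : Fin n} {C : Finset (Fin n)} (hi : i ∉ C)
    (x : Fin n → Fin d → ℝ) :
    (∫⋯∫⁻_C, (fun x => ENNReal.ofReal (phiFinset (pairW β φ) (x i) C x)) ∂(fun _ => volume)) x =
      gCoef β φ C.card := by
  rw [lmarginal_eq_lintegral_of_equiv volume C (C.orderIsoOfFin rfl).toEquiv,
    ← lintegral_phiVertex_pairW C.card (x i)]
  refine lintegral_congr fun y => ?_
  rw [phiFinset_eq_phiVertex _ _ C (C.orderIsoOfFin rfl)]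
  congr 2
  · simp [Function.updateFinset, hi]
  · funext k
    refine (dif_pos (Subtype.coe_prop _)).trans ?_
    exact congrArg y ((C.orderIsoOfFin rfl).symm_apply_apply k)

theorem gCoef_zero : gCoef β φ 0 = 1 := by
  simp [gCoef, phiVertex, volume_pi]

theorem lintegral_treeB_le (hβ : 0 ≤ β) (hφ : Measurable φ) (n N : ℕ) (hN : n + 1 ≤ N) :
    ∫⁻ y : Fin n → Fin d → ℝ, ENNReal.ofReal (treeB (pairW β φ) n (Fin.cons 0 y)) ≤
      n.factorial * forestCoef (fun k => gCoef β φ k / k.factorial) N 1 n := by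
  have hcard : (({0}ᶜ : Finset (Fin (n + 1)))).card = n := by simp [Finset.card_compl]
  let e : Fin n ≃ ({0}ᶜ : Finset (Fin (n + 1))) :=
    Equiv.ofBijective (fun i => ⟨i.succ, by simp⟩)
      ⟨fun i j h => by simpa using h, fun ⟨i, hi⟩ => by
        obtain ⟨j, rfl⟩ := Fin.exists_succ_eq.2 (by simpa using hi)
        exact ⟨j, rfl⟩⟩
  have hcons : ∀ y : Fin n → Fin d → ℝ,
      Function.updateFinset (fun _ => 0) {0}ᶜ (y ∘ e.symm) =
        (Fin.cons 0 y : Fin (n + 1) → Fin d → ℝ) := by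
    intro y
    funext i
    refine Fin.cases ?_ (fun j => ?_) i
    · simp [Function.updateFinset]
    · have : e.symm ⟨j.succ, by simp⟩ = j := e.symm_apply_apply j
      simp [Function.updateFinset, this]
  have h := lmarginal_forestSum_le volume
    (fun (x : Fin (n + 1) → Fin d → ℝ) i C => ENNReal.ofReal (phiFinset (pairW β φ) (x i) C x))
    (fun i C => (measurable_phiFinset_pairW hφ i C).ennreal_ofReal)
    (fun i C x y hxy => by
      have hC : ∀ j ∈ C, x j = y j := fun j hj => hxy j (Finset.mem_insert_of_mem hj)
      simp only [phiFinset, hxy i (Finset.mem_insert_self i C)]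
      congr 2
      · exact Finset.prod_congr rfl fun j hj => by rw [hC j hj]
      · refine Finset.prod_congr rfl fun p hp => ?_
        have := Finset.mem_product.1 (Finset.mem_filter.1 hp).1
        rw [hC _ this.1, hC _ this.2])
    (gCoef β φ) (fun i C x hi => lmarginal_phiFinset_pairW hi x) N {0} {0}ᶜ
    disjoint_compl_right (by rw [hcard, Finset.card_singleton]; omega) fun _ => 0
  rw [hcard, Finset.card_singleton, lmarginal_eq_lintegral_of_equiv volume _ e] at h
  simp_rw [hcons] at h
  exact (lintegral_mono fun y => ofReal_treeB_le_forestSum _ pairW_nonneg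
    (pairW_le_one hβ) _ _).trans h

theorem vertexSum_eq_tsum (t : ℝ≥0∞) :
    vertexSum β φ t = ∑' k : ℕ, gCoef β φ k / k.factorial * t ^ k := by
  rw [tsum_eq_zero_add' ENNReal.summable, vertexSum, gCoef_zero]
  simp only [Nat.factorial_zero, Nat.cast_one, div_one, pow_zero, mul_one]
  congr 1
  refine tsum_congr fun n => ?_
  rw [div_eq_mul_inv, div_eq_mul_inv]
  ring

theorem vertexSum_mono {s t : ℝ≥0∞} (h : s ≤ t) : vertexSum β φ s ≤ vertexSum β φ t := by
  unfold vertexSum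
  gcongr

/-- The convexity bound for the vertex sum, which equals `1` at `0`. -/
theorem vertexSum_le_of_le {s t : ℝ≥0∞} (h : s ≤ t) (ht0 : t ≠ 0) (ht : t ≠ ∞) :
    vertexSum β φ s ≤ 1 + s / t * vertexSum β φ t := by
  unfold vertexSum
  gcongr
  refine le_trans ?_ (mul_le_mul_right le_add_self _)
  rw [← ENNReal.tsum_mul_left]
  refine ENNReal.tsum_le_tsum fun n => ?_
  calc _ ≤ gCoef β φ (n + 1) * (t ^ n * s) / ((n + 1).factorial : ℝ≥0∞) := by
        rw [pow_succ]; gcongr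
    _ = gCoef β φ (n + 1) * (t ^ n * (s / t * t)) / ((n + 1).factorial : ℝ≥0∞) := by
        rw [ENNReal.div_mul_cancel ht0 ht]
    _ = _ := by
        simp only [div_eq_mul_inv]; ring

/-- The tree sum is bounded by any supersolution of the fixed point equation `H = Ψ(r H)`. -/
theorem treeSum_le_of_vertexSum_le (hβ : 0 ≤ β) (hφ : Measurable φ) {r : ℝ} (hr : 0 ≤ r)
    {H : ℝ≥0∞} (hH : vertexSum β φ (ENNReal.ofReal r * H) ≤ H) : treeSum β φ r ≤ H := by
  have hH1 : 1 ≤ H := le_trans (by simp [vertexSum]) hH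
  rw [treeSum, ENNReal.tsum_eq_iSup_nat, ENNReal.add_iSup]
  refine iSup_le fun M => ?_
  rw [vertexSum_eq_tsum] at hH
  refine le_trans ?_ ((ENNReal.sum_le_tsum (Finset.range (M + 1))).trans
    ((tsum_forestCoef_le _ _ H hH1 hH (M + 1) 1).trans_eq (pow_one H)))
  rw [Finset.sum_range_succ', add_comm]
  refine add_le_add (Finset.sum_le_sum fun n hn => ?_) ?_
  · have hfac : (((n + 1).factorial : ℕ) : ℝ≥0∞) ≠ 0 := by
      exact_mod_cast (n + 1).factorial_ne_zero
    calc _ ≤ ENNReal.ofReal (r ^ (n + 1) / (n + 1).factorial) * ((n + 1).factorial *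
            forestCoef (fun k => gCoef β φ k / k.factorial) (M + 1) 1 (n + 1)) := by
          gcongr
          exact lintegral_treeB_le hβ hφ (n + 1) (M + 1) (by
            have := Finset.mem_range.1 hn; omega)
      _ = _ := by
          rw [ENNReal.ofReal_div_of_pos (by positivity), ENNReal.ofReal_natCast,
            ENNReal.ofReal_pow hr, ← mul_assoc,
            ENNReal.div_mul_cancel hfac (ENNReal.natCast_ne_top _)]
  · simp [forestCoef, forestCoef_zero_roots, gCoef_zero]

end pairW

/-- simple bound on the tree sum. -/
theorem statement12 {d : ℕ} (hd : 1 ≤ d) (β : ℝ) (hβ : 0 < β)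
    (φ : (Fin d → ℝ) → ℝ≥0∞) (hφm : Measurable φ) (hφeven : ∀ v, φ (-v) = φ v)
    (hT : ∫⁻ v : Fin d → ℝ, ENNReal.ofReal (1 - pairW β φ v 0) < ∞)
    (z : ℂ) (μ : ℝ) (hμ : 0 < μ)
    (hz : ENNReal.ofReal ‖z‖ < ENNReal.ofReal μ / vertexSum β φ (ENNReal.ofReal μ)) :
    treeSum β φ ‖z‖ < ∞ ∧
    treeSum β φ ‖z‖
      ≤ (1 - ENNReal.ofReal ‖z‖ * vertexSum β φ (ENNReal.ofReal μ) / ENNReal.ofReal μ)⁻¹ := by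
  set R := ENNReal.ofReal ‖z‖
  set m := ENNReal.ofReal μ
  set P := vertexSum β φ m
  have hm0 : m ≠ 0 := (ENNReal.ofReal_pos.2 hμ).ne'
  have hm : m ≠ ∞ := ENNReal.ofReal_ne_top
  have hR : R ≠ ∞ := ENNReal.ofReal_ne_top
  have hP0 : P ≠ 0 := (zero_lt_one.trans_le (by simp [P, vertexSum])).ne'
  have hP : P ≠ ∞ := by
    intro h
    simp [h] at hz
  have hRP : R * P < m := (ENNReal.lt_div_iff_mul_lt (Or.inl hP0) (Or.inl hP)).1 hz
  have hq : R * P / m < 1 := by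
    rw [ENNReal.div_lt_iff (Or.inl hm0) (Or.inl hm), one_mul]
    exact hRP
  set q := R * P / m with hq_def
  have hq0 : 1 - q ≠ 0 := (tsub_pos_of_lt hq).ne'
  set H := (1 - q)⁻¹
  have hH : 1 + q * H = H := by
    calc 1 + q * H = (1 - q) * H + q * H := by
          rw [ENNReal.mul_inv_cancel hq0 (ENNReal.sub_ne_top ENNReal.one_ne_top)]
      _ = H := by rw [← add_mul, tsub_add_cancel_of_le hq.le, one_mul]
  have hle : R * min H (m / R) ≤ m :=
    (mul_le_mul_right (min_le_right _ _) _).trans ENNReal.mul_div_le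
  have key : treeSum β φ ‖z‖ ≤ min H (m / R) := by
    refine treeSum_le_of_vertexSum_le hβ.le hφm (norm_nonneg z) (le_min ?_ ?_)
    · calc _ ≤ 1 + R * min H (m / R) / m * P := vertexSum_le_of_le hle hm0 hm
        _ = 1 + q * min H (m / R) := by
            simp only [hq_def, div_eq_mul_inv]; ring
        _ ≤ 1 + q * H := by gcongr; exact min_le_left _ _
        _ = H := hH
    · refine (vertexSum_mono hle).trans ?_
      rw [ENNReal.le_div_iff_mul_le (Or.inr hm0) (Or.inl hR), mul_comm]
      exact hRP.le
  have hfin := key.trans (min_le_left _ _)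
  exact ⟨hfin.trans_lt (ENNReal.inv_lt_top.2 (tsub_pos_of_lt hq)), hfin⟩
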